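/- arXiv:1601.03225 — 2 statements merged into one kernel-verified Lean document; each statement's English description precedes it below -/
import Mathlib

section
/- Every finite tree with maximum degree Δ admits a distance-2 coloring using at most Δ+1 colors, i.e., a distance-2 coloring taking values in the set {0, 1, ..., Δ}. -/
/-- `c` is a distance-2 coloring of `G`: any two distinct vertices that are adjacent
or share a common neighbor receive different colors. -/
def IsD2Coloring {V : Type*} {α : Type*} (G : SimpleGraph V) (c : V → α) : Prop :=
  ∀ u v : V, u ≠ v → (G.Adj u v ∨ ∃ w : V, G.Adj u w ∧ G.Adj w v) → c u ≠ c v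

theorem d2_aux.{u} (D : ℕ) (n : ℕ) : ∀ {V : Type u} [Fintype V] (G : SimpleGraph V),
    Fintype.card V = n → G.IsTree → (∀ v, (G.neighborSet v).ncard ≤ D) →
    ∃ c : V → ℕ, (∀ v : V, c v ≤ D) ∧ IsD2Coloring G c := by
  induction n with
  | zero =>
    intro V _ G hc hT _
    have := hT.1.nonempty
    exact absurd hc Fintype.card_ne_zero
  | succ n ih =>
    intro V _ G hc hT hD
    classical
    rcases subsingleton_or_nontrivial V with hs | hn
    · exact ⟨fun _ => 0, fun _ => Nat.zero_le _, fun u v h => absurd (Subsingleton.elim u v) h⟩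
    obtain ⟨v, hv⟩ := hT.exists_vert_degree_one_of_nontrivial
    obtain ⟨w, hw, hwu⟩ := SimpleGraph.degree_eq_one_iff_existsUnique_adj.1 hv
    have hT' : (G.induce {v}ᶜ).IsTree :=
      ⟨hT.1.induce_compl_singleton_of_degree_eq_one hv, hT.2.induce _⟩
    obtain ⟨c, hcD, hc2⟩ := ih (V := ({v}ᶜ : Set V)) (G.induce {v}ᶜ)
      (by rw [Fintype.card_compl_set]; simp [hc]) hT' (by
        intro x
        refine le_trans ?_ (hD x)
        rw [← Set.ncard_image_of_injective _ Subtype.val_injective]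
        apply Set.ncard_le_ncard _ (Set.toFinite _)
        rintro _ ⟨y, hy, rfl⟩
        exact hy)
    let e : V → ℕ := fun x => if h : x ≠ v then c ⟨x, h⟩ else 0
    have he : ∀ x (h : x ≠ v), e x = c ⟨x, h⟩ := fun x h => dif_pos h
    have hwv : w ≠ v := hw.ne'
    obtain ⟨a, haD, ha⟩ : ∃ a ∈ Finset.range (D + 1),
        a ∉ (insert w ((G.neighborFinset w).erase v)).image e := by
      apply Finset.exists_mem_notMem_of_card_lt_card
      refine lt_of_le_of_lt Finset.card_image_le ?_
      refine lt_of_le_of_lt (Finset.card_insert_le _ _) ?_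
      have h1 : (G.neighborFinset w).card ≤ D := by
        have := hD w
        rwa [← SimpleGraph.coe_neighborFinset, Set.ncard_coe_finset] at this
      have h2 : v ∈ G.neighborFinset w := by simpa using hw.symm
      have := Finset.card_erase_add_one h2
      rw [Finset.card_range]
      omega
    have ha1 : ∀ x, x ≠ v → (G.Adj v x ∨ ∃ y, G.Adj v y ∧ G.Adj y x) → e x ≠ a := by
      intro x hx h hxa
      apply ha
      refine Finset.mem_image.2 ⟨x, ?_, hxa⟩
      rcases h with h | ⟨y, hy, h⟩
      · rw [hwu x h]; simp
      · rw [hwu y hy] at h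
        simp [hx, h]
    refine ⟨fun x => if x = v then a else e x, ?_, ?_⟩
    · intro x
      by_cases hx : x = v
      · simp only [hx, if_true]
        have := Finset.mem_range.1 haD
        omega
      · simp only [hx, if_false]
        rw [he x hx]; exact hcD _
    · intro x y hxy h
      by_cases hx : x = v
      · subst hx
        simp only [if_true, if_neg hxy.symm]
        exact (ha1 y hxy.symm h).symm
      · by_cases hy : y = v
        · subst hy
          simp only [if_true, if_neg hx]
          refine ha1 x hx ?_
          rcases h with h | ⟨z, h1, h2⟩
          · exact Or.inl h.symm
          · exact Or.inr ⟨z, h2.symm, h1.symm⟩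
        · simp only [if_neg hx, if_neg hy]
          rw [he x hx, he y hy]
          apply hc2 _ _ (fun hh => hxy (congrArg Subtype.val hh))
          rcases h with h | ⟨z, h1, h2⟩
          · exact Or.inl h
          · refine Or.inr ⟨⟨z, ?_⟩, h1, h2⟩
            rintro rfl
            exact hxy ((hwu x h1.symm).trans (hwu y h2).symm)

/-- Every finite tree with maximum degree `Δ` admits a distance-2 coloring
with values in `{0, 1, ..., Δ}`. -/
theorem tree_d2Coloring_exists {V : Type*} [Fintype V]
    (G : SimpleGraph V) [DecidableRel G.Adj] (hT : G.IsTree) :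
    ∃ c : V → ℕ, (∀ v : V, c v ≤ G.maxDegree) ∧ IsD2Coloring G c := by
  refine d2_aux G.maxDegree _ G rfl hT ?_
  intro v
  rw [← SimpleGraph.coe_neighborFinset, Set.ncard_coe_finset]
  exact G.degree_le_maxDegree v
end

section
/- Let T be a finite tree on vertex set V with maximum degree Δ ≥ 1, let c be a distance-2 coloring of T with values in {0, 1, ..., Δ}, and let v ∈ V be a vertex with deg(v) < Δ. Form the graph T' on the vertex set V together with one new vertex, where the new vertex is adjacent exactly to v and all edges of T are retained. Then T' is a tree with maximum degree Δ, and T' admits a distance-2 coloring c' with values in {0, 1, ..., Δ} that agrees with c on all vertices of V. -/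
/-- The graph on `Option V` obtained from `G` by adding one new vertex (`none`)
adjacent exactly to `v`, keeping all edges of `G`. -/
def attachLeaf {V : Type*} (G : SimpleGraph V) (v : V) : SimpleGraph (Option V) :=
  SimpleGraph.fromRel fun a b =>
    (∃ x y : V, a = some x ∧ b = some y ∧ G.Adj x y) ∨ (a = none ∧ b = some v)

lemma al_ss {V : Type*} (G : SimpleGraph V) (v x y : V) :
    (attachLeaf G v).Adj (some x) (some y) ↔ G.Adj x y := by
  simp only [attachLeaf, SimpleGraph.fromRel_adj]
  constructor
  · rintro ⟨-, (⟨a, b, h1, h2, h⟩ | h) | (⟨a, b, h1, h2, h⟩ | h)⟩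
    · cases h1; cases h2; exact h
    · simp at h
    · cases h1; cases h2; exact h.symm
    · simp at h
  · intro h
    exact ⟨by simpa using h.ne, Or.inl (Or.inl ⟨x, y, rfl, rfl, h⟩)⟩

lemma al_ns {V : Type*} (G : SimpleGraph V) (v y : V) :
    (attachLeaf G v).Adj none (some y) ↔ y = v := by
  simp [attachLeaf, SimpleGraph.fromRel_adj]

lemma al_sn {V : Type*} (G : SimpleGraph V) (v y : V) :
    (attachLeaf G v).Adj (some y) none ↔ y = v := by
  rw [SimpleGraph.adj_comm, al_ns]

lemma al_edgeSet {V : Type*} (G : SimpleGraph V) (v : V) :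
    (attachLeaf G v).edgeSet =
      insert s(none, some v) (Sym2.map some '' G.edgeSet) := by
  ext e
  induction e with
  | _ a b =>
  rw [SimpleGraph.mem_edgeSet, Set.mem_insert_iff]
  have key : s(a, b) ∈ Sym2.map some '' G.edgeSet ↔
      ∃ x y, a = some x ∧ b = some y ∧ G.Adj x y := by
    constructor
    · rintro ⟨e, he, h⟩
      induction e with
      | _ x y =>
      rw [SimpleGraph.mem_edgeSet] at he
      rw [Sym2.map_mk, Sym2.eq_iff] at h
      rcases h with ⟨h1, h2⟩ | ⟨h1, h2⟩
      · exact ⟨x, y, h1.symm, h2.symm, he⟩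
      · exact ⟨y, x, h2.symm, h1.symm, he.symm⟩
    · rintro ⟨x, y, rfl, rfl, h⟩
      exact ⟨s(x, y), h, rfl⟩
  rw [key]
  cases a <;> cases b <;> simp [al_ss, al_ns, al_sn]

lemma al_isTree {V : Type*} [Finite V] (G : SimpleGraph V) (hT : G.IsTree) (v : V) :
    (attachLeaf G v).IsTree := by
  rw [SimpleGraph.isTree_iff_connected_and_card] at hT ⊢
  obtain ⟨hC, hcard⟩ := hT
  constructor
  · rw [SimpleGraph.connected_iff_exists_forall_reachable]
    refine ⟨some v, fun w => ?_⟩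
    cases w with
    | none => exact ((al_sn G v v).2 rfl).reachable
    | some w =>
      let f : G →g attachLeaf G v := ⟨some, fun h => (al_ss G v _ _).2 h⟩
      exact (hC.preconnected v w).map f
  · have hn : s(none, some v) ∉ Sym2.map some '' G.edgeSet := by
      rintro ⟨e, -, h⟩
      induction e with
      | _ x y => simp at h
    rw [al_edgeSet, Nat.card_coe_set_eq, Set.ncard_insert_of_notMem hn (Set.toFinite _),
      Set.ncard_image_of_injective _ (Sym2.map.injective (Option.some_injective V)),
      Finite.card_option, ← Nat.card_coe_set_eq, hcard]

lemma al_degree_le {V : Type*} [Fintype V] [DecidableEq V]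
    (G : SimpleGraph V) [DecidableRel G.Adj] (hΔ : 1 ≤ G.maxDegree)
    (v : V) (hv : G.degree v < G.maxDegree) [DecidableRel (attachLeaf G v).Adj] :
    (attachLeaf G v).maxDegree = G.maxDegree := by
  apply le_antisymm
  · apply SimpleGraph.maxDegree_le_of_forall_degree_le
    intro w
    rw [← SimpleGraph.card_neighborFinset_eq_degree]
    cases w with
    | none =>
      refine le_trans (Finset.card_le_card (t := {some v}) ?_) (by simpa using hΔ)
      intro y hy
      rw [SimpleGraph.mem_neighborFinset] at hy
      cases y with
      | none => simp at hy
      | some y => simpa [al_ns] using hy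
    | some x =>
      by_cases hx : x = v
      · subst hx
        refine le_trans (Finset.card_le_card
          (t := insert none ((G.neighborFinset x).image some)) ?_) ?_
        · intro y hy
          rw [SimpleGraph.mem_neighborFinset] at hy
          cases y with
          | none => simp
          | some y => simpa [al_ss] using hy
        · refine le_trans (Finset.card_insert_le _ _) ?_
          have := Finset.card_image_le (s := G.neighborFinset x) (f := some)
          rw [SimpleGraph.card_neighborFinset_eq_degree] at this
          omega
      · refine le_trans (Finset.card_le_card
          (t := (G.neighborFinset x).image some) ?_) ?_
        · intro y hy
          rw [SimpleGraph.mem_neighborFinset] at hy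
          cases y with
          | none => exact absurd ((al_sn G v x).1 hy) hx
          | some y => simpa [al_ss] using hy
        · refine le_trans Finset.card_image_le ?_
          rw [SimpleGraph.card_neighborFinset_eq_degree]
          exact G.degree_le_maxDegree x
  · apply SimpleGraph.maxDegree_le_of_forall_degree_le
    intro x
    refine le_trans ?_ ((attachLeaf G v).degree_le_maxDegree (some x))
    rw [← SimpleGraph.card_neighborFinset_eq_degree, ← SimpleGraph.card_neighborFinset_eq_degree,
      ← Finset.card_image_of_injective _ (Option.some_injective V)]
    apply Finset.card_le_card
    intro y hy
    rw [Finset.mem_image] at hy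
    obtain ⟨z, hz, rfl⟩ := hy
    rw [SimpleGraph.mem_neighborFinset] at hz ⊢
    exact (al_ss G v x z).2 hz

/-- Attaching a new leaf to a vertex `v` of degree `< Δ` of a finite tree of maximum
degree `Δ ≥ 1` yields a tree with maximum degree `Δ`, and any distance-2 coloring with
values in `{0, ..., Δ}` extends to such a coloring of the new tree, unchanged on the
old vertices. -/
theorem tree_attachLeaf_extend_coloring {V : Type*} [Fintype V] [DecidableEq V]
    (G : SimpleGraph V) [DecidableRel G.Adj] (hT : G.IsTree) (hΔ : 1 ≤ G.maxDegree)
    (c : V → ℕ) (hle : ∀ u : V, c u ≤ G.maxDegree) (hc : IsD2Coloring G c)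
    (v : V) (hv : G.degree v < G.maxDegree) :
    (attachLeaf G v).IsTree ∧
    (@SimpleGraph.maxDegree (Option V) (attachLeaf G v) _ (Classical.decRel _) =
      G.maxDegree) ∧
    ∃ c' : Option V → ℕ, (∀ w : Option V, c' w ≤ G.maxDegree) ∧
      IsD2Coloring (attachLeaf G v) c' ∧ ∀ u : V, c' (some u) = c u := by
  refine ⟨al_isTree G hT v, @al_degree_le V _ _ G _ hΔ v hv (Classical.decRel _), ?_⟩
  obtain ⟨k, hk, hk'⟩ : ∃ k ∈ Finset.range (G.maxDegree + 1),
      k ∉ (insert v (G.neighborFinset v)).image c := by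
    apply Finset.exists_mem_notMem_of_card_lt_card
    have h1 := Finset.card_image_le (s := insert v (G.neighborFinset v)) (f := c)
    have h2 := Finset.card_insert_le v (G.neighborFinset v)
    rw [SimpleGraph.card_neighborFinset_eq_degree] at h2
    rw [Finset.card_range]
    omega
  have hkn : ∀ x, x = v ∨ G.Adj v x → c x ≠ k := by
    intro x hx h
    apply hk'
    rw [Finset.mem_image]
    exact ⟨x, by simpa using hx, h⟩
  have hnone : ∀ x, ((attachLeaf G v).Adj none (some x) ∨
      ∃ w, (attachLeaf G v).Adj none w ∧ (attachLeaf G v).Adj w (some x)) → c x ≠ k := by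
    rintro x (h | ⟨w, h1, h2⟩)
    · exact hkn x (Or.inl ((al_ns G v x).1 h))
    · cases w with
      | none => simp at h1
      | some w =>
        rw [al_ns] at h1
        subst h1
        exact hkn x (Or.inr ((al_ss G w w x).1 h2))
  refine ⟨fun w => w.elim k c, ?_, ?_, fun u => rfl⟩
  · intro w
    cases w with
    | none => exact Nat.lt_succ_iff.1 (Finset.mem_range.1 hk)
    | some w => exact hle w
  · intro a b hab h
    cases a with
    | none =>
      cases b with
      | none => exact absurd rfl hab
      | some b => exact (hnone b h).symm
    | some a =>
      cases b with
      | none =>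
        refine hnone a ?_
        rcases h with h | ⟨w, h1, h2⟩
        · exact Or.inl h.symm
        · exact Or.inr ⟨w, h2.symm, h1.symm⟩
      | some b =>
        have hab' : a ≠ b := fun h => hab (congrArg some h)
        refine hc a b hab' ?_
        rcases h with h | ⟨w, h1, h2⟩
        · exact Or.inl ((al_ss G v a b).1 h)
        · cases w with
          | none =>
            rw [al_sn] at h1
            rw [al_ns] at h2
            exact absurd (h1.trans h2.symm) hab'
          | some w => exact Or.inr ⟨w, (al_ss G v _ _).1 h1, (al_ss G v _ _).1 h2⟩
end
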